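/- Let S = {(1,1),(1,−1),(−1,1),(−1,−1)} (the diagonal walk, Model 2). Then the interacting generating function G_S(t;a,b) ∈ ℚ[a,b][[t]] is D-finite. -/

import Mathlib

open PowerSeries

/-- A quarter-plane loop of length `n` with steps in `S`: a sequence of points of
`ℤ≥0 × ℤ≥0` (encoded as `ℕ × ℕ`) starting and ending at the origin, with successive
differences in `S`. -/
def IsQPLoop (S : Set (ℤ × ℤ)) (n : ℕ) (w : Fin (n + 1) → ℕ × ℕ) : Prop :=
  w 0 = (0, 0) ∧ w (Fin.last n) = (0, 0) ∧
    ∀ i : Fin n, (((w i.succ).1 : ℤ) - ((w i.castSucc).1 : ℤ),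
      ((w i.succ).2 : ℤ) - ((w i.castSucc).2 : ℤ)) ∈ S

/-- The number of visits of `w` to the horizontal boundary: indices `1 ≤ i ≤ n`
with the second coordinate of `w i` equal to `0`. -/
def hvisits {n : ℕ} (w : Fin (n + 1) → ℕ × ℕ) : ℕ :=
  (Finset.univ.filter fun i : Fin (n + 1) => 0 < (i : ℕ) ∧ (w i).2 = 0).card

/-- The number of visits of `w` to the vertical boundary: indices `1 ≤ i ≤ n`
with the first coordinate of `w i` equal to `0`. -/
def vvisits {n : ℕ} (w : Fin (n + 1) → ℕ × ℕ) : ℕ :=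
  (Finset.univ.filter fun i : Fin (n + 1) => 0 < (i : ℕ) ∧ (w i).1 = 0).card

/-- The interacting generating function `G_S(t;a,b) = Σ_n t^n Σ_w a^(h(w)) b^(v(w))`,
the inner sum over all quarter-plane loops of length `n` with steps in `S`. -/
noncomputable def loopGF (S : Set (ℤ × ℤ)) {R : Type*} [CommRing R] (a b : R) :
    PowerSeries R :=
  PowerSeries.mk fun n =>
    ∑ᶠ w : {w : Fin (n + 1) → ℕ × ℕ // IsQPLoop S n w}, a ^ hvisits w.1 * b ^ vvisits w.1

/-- A power series `F ∈ R[[t]]` is D-finite if there are polynomials `p₀, …, p_m`,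
not all zero, with `Σ pᵢ · F⁽ⁱ⁾ = 0`, where `F⁽ⁱ⁾` is the `i`-th formal derivative. -/
def IsDFinite {R : Type*} [CommRing R] (F : PowerSeries R) : Prop :=
  ∃ (m : ℕ) (p : Fin (m + 1) → Polynomial R), (∃ i, p i ≠ 0) ∧
    ∑ i : Fin (m + 1), (p i : PowerSeries R) * (PowerSeries.derivativeFun)^[(i : ℕ)] F = 0

/-- One-dimensional walks on `ℕ` with steps `±1`, of length `n`, from `0` to `j`. -/
def dyckWalks : (n : ℕ) → ℕ → Finset (Fin (n + 1) → ℕ)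
  | 0, 0 => {fun _ => 0}
  | 0, _ + 1 => ∅
  | n + 1, 0 => (dyckWalks n 1).image fun w => Fin.snoc (α := fun _ => ℕ) w 0
  | n + 1, j + 1 =>
    (dyckWalks n j ∪ dyckWalks n (j + 2)).image fun w => Fin.snoc (α := fun _ => ℕ) w (j + 1)

theorem mem_dyckWalks {n j : ℕ} {w : Fin (n + 1) → ℕ} :
    w ∈ dyckWalks n j ↔ w 0 = 0 ∧ w (Fin.last n) = j ∧
      ∀ i : Fin n, w i.succ = w i.castSucc + 1 ∨ w i.castSucc = w i.succ + 1 := by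
  induction n generalizing j with
  | zero =>
    cases j with
    | zero =>
      simp only [dyckWalks, Finset.mem_singleton]
      constructor
      · rintro rfl
        simp
      · rintro ⟨h, -, -⟩
        funext i
        rw [Fin.fin_one_eq_zero i, h]
    | succ j =>
      simp only [dyckWalks, Finset.notMem_empty, false_iff, not_and]
      intro h h'
      have : w 0 = j + 1 := h'
      omega
  | succ n ih =>
    have key : (w 0 = 0 ∧ w (Fin.last (n + 1)) = j ∧
        ∀ i : Fin (n + 1), w i.succ = w i.castSucc + 1 ∨ w i.castSucc = w i.succ + 1) ↔
        ∃ k, (k = j + 1 ∨ j = k + 1) ∧ ∃ v ∈ dyckWalks n k,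
          Fin.snoc (α := fun _ => ℕ) v j = w := by
      constructor
      · rintro ⟨h0, hl, hs⟩
        refine ⟨w (Fin.last n).castSucc, ?_, fun i => w i.castSucc, ih.2 ⟨h0, rfl, fun i => ?_⟩, ?_⟩
        · have := hs (Fin.last n)
          rw [Fin.succ_last, hl] at this
          exact this.symm
        · exact hs i.castSucc
        · subst hl
          exact Fin.snoc_init_self (α := fun _ => ℕ) w
      · rintro ⟨k, hk, v, hv, rfl⟩
        obtain ⟨h0, hl, hs⟩ := ih.1 hv
        refine ⟨?_, by simp, fun i => ?_⟩
        · rw [← Fin.castSucc_zero, Fin.snoc_castSucc, h0]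
        · induction i using Fin.lastCases with
          | last => rw [Fin.succ_last, Fin.snoc_last, Fin.snoc_castSucc, hl]; omega
          | cast i => rw [Fin.succ_castSucc, Fin.snoc_castSucc, Fin.snoc_castSucc]; exact hs i
    rw [key]
    cases j with
    | zero => simp [dyckWalks]
    | succ j =>
      simp only [dyckWalks, Finset.mem_image, Finset.mem_union]
      constructor
      · rintro ⟨v, hv | hv, h⟩
        · exact ⟨j, Or.inr rfl, v, hv, h⟩
        · exact ⟨j + 2, Or.inl rfl, v, hv, h⟩
      · rintro ⟨k, hk | hk, v, hv, h⟩
        · exact ⟨v, Or.inr (hk ▸ hv), h⟩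
        · obtain rfl : j = k := by omega
          exact ⟨v, Or.inl hv, h⟩

/-- The number of returns of a walk to `0`. -/
def returns {n : ℕ} (w : Fin (n + 1) → ℕ) : ℕ :=
  (Finset.univ.filter fun i : Fin (n + 1) => 0 < (i : ℕ) ∧ w i = 0).card

theorem returns_snoc {n : ℕ} (w : Fin (n + 1) → ℕ) (j : ℕ) :
    returns (Fin.snoc (α := fun _ => ℕ) w j : Fin (n + 2) → ℕ) =
      returns w + if j = 0 then 1 else 0 := by
  simp only [returns, Finset.card_filter]
  rw [Fin.sum_univ_castSucc]
  simp

section WalkWeight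

variable {R : Type*} [CommRing R]

/-- Walks of length `n` from `0` to `j`, counted with weight `a` for each return to `0`. -/
def walkWeight (a : R) (n j : ℕ) : R := ∑ w ∈ dyckWalks n j, a ^ returns w

theorem snoc_injective {n : ℕ} (j : ℕ) : Function.Injective fun w : Fin n → ℕ =>
    (Fin.snoc (α := fun _ => ℕ) w j : Fin (n + 1) → ℕ) :=
  Fin.snoc_left_injective (α := fun _ => ℕ) j

theorem walkWeight_zero_zero (a : R) : walkWeight a 0 0 = 1 := by
  simp [walkWeight, dyckWalks, returns]

theorem walkWeight_zero_succ (a : R) (j : ℕ) : walkWeight a 0 (j + 1) = 0 := by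
  simp [walkWeight, dyckWalks]

theorem walkWeight_succ_zero (a : R) (n : ℕ) :
    walkWeight a (n + 1) 0 = a * walkWeight a n 1 := by
  simp only [walkWeight, dyckWalks]
  rw [Finset.sum_image fun _ _ _ _ h => snoc_injective 0 h, Finset.mul_sum]
  simp [returns_snoc, pow_succ']

theorem walkWeight_succ_succ (a : R) (n j : ℕ) :
    walkWeight a (n + 1) (j + 1) = walkWeight a n j + walkWeight a n (j + 2) := by
  simp only [walkWeight, dyckWalks]
  rw [Finset.sum_image fun _ _ _ _ h => snoc_injective (j + 1) h, Finset.sum_union]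
  · simp [returns_snoc]
  · refine Finset.disjoint_left.2 fun w h h' => ?_
    have := (mem_dyckWalks.1 h).2.1
    have := (mem_dyckWalks.1 h').2.1
    omega

/-- Walks from `0` to `j + 1` without return correspond to walks to `j` one step shorter; those with
a return are equinumerous with walks to `j + 2` having one step and one return less. -/
theorem walkWeight_first_step (a : R) (n j : ℕ) :
    walkWeight a (n + 1) (j + 1) = walkWeight 1 n j + a * walkWeight a n (j + 2) := by
  induction n generalizing j with
  | zero =>
    rw [walkWeight_succ_succ]
    cases j <;> simp [walkWeight_zero_zero, walkWeight_zero_succ]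
  | succ n ih =>
    have h := walkWeight_succ_succ a n (j + 1)
    rw [walkWeight_succ_succ]
    cases j with
    | zero =>
      rw [walkWeight_succ_zero, walkWeight_succ_zero]
      linear_combination ih 1 - a * h
    | succ j =>
      rw [ih j, walkWeight_succ_succ 1 n j]
      linear_combination ih (j + 2) - a * h

theorem walkWeight_recurrence (a : R) (n : ℕ) :
    (1 - a) * walkWeight a (n + 2) 0 = a * walkWeight 1 n 0 - a ^ 2 * walkWeight a n 0 := by
  have h1 := walkWeight_succ_zero a (n + 1)
  have h2 := walkWeight_first_step a n 0
  have h3 := walkWeight_succ_succ a n 0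
  simp only [zero_add] at h2 h3
  rw [h1]
  linear_combination a * h2 - a ^ 2 * h3

theorem ballot_recurrence [IsDomain R] [CharZero R] (n j : ℕ) :
    ((j + 1) * (n + j + 4) : R) * walkWeight 1 n (j + 2) =
      (j + 3) * (n - j) * walkWeight 1 n j := by
  induction n generalizing j with
  | zero =>
    cases j with
    | zero => simp [walkWeight_zero_succ]
    | succ j => simp [walkWeight_zero_succ]
  | succ n ih =>
    have h := ih (j + 1)
    have hs := walkWeight_succ_succ (1 : R) n (j + 1)
    have hj2 : (j + 2 : R) ≠ 0 := by exact_mod_cast (by omega : j + 2 ≠ 0)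
    cases j with
    | zero =>
      rw [walkWeight_succ_zero, hs]
      apply mul_left_cancel₀ hj2
      push_cast at h ⊢
      linear_combination h
    | succ j =>
      have h' := ih j
      rw [walkWeight_succ_succ 1 n j, hs]
      apply mul_left_cancel₀ hj2
      push_cast at h ⊢
      linear_combination (j + 2 : R) * h + (j + 4 : R) * h'

theorem catalan_recurrence [IsDomain R] [CharZero R] (n : ℕ) :
    (n + 4 : R) * walkWeight 1 (n + 2) 0 = 4 * (n + 1) * walkWeight 1 n 0 := by
  have h := ballot_recurrence (R := R) n 0
  have h' := walkWeight_succ_succ (1 : R) n 0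
  rw [walkWeight_succ_zero]
  simp only [zero_add] at h h'
  rw [h']
  push_cast at h
  linear_combination h

theorem walkWeight_one_zero (a : R) : walkWeight a 1 0 = 0 := by
  rw [walkWeight_succ_zero, walkWeight_zero_succ, mul_zero]

end WalkWeight

theorem diagonalLoop_iff {n : ℕ} (w : Fin (n + 1) → ℕ × ℕ) :
    IsQPLoop ({((1 : ℤ), (1 : ℤ)), (1, -1), (-1, 1), (-1, -1)} : Set (ℤ × ℤ)) n w ↔
      (fun i => (w i).1) ∈ dyckWalks n 0 ∧ (fun i => (w i).2) ∈ dyckWalks n 0 := by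
  have step (i : Fin n) : (((w i.succ).1 : ℤ) - ((w i.castSucc).1 : ℤ),
      ((w i.succ).2 : ℤ) - ((w i.castSucc).2 : ℤ)) ∈
        ({((1 : ℤ), (1 : ℤ)), (1, -1), (-1, 1), (-1, -1)} : Set (ℤ × ℤ)) ↔
      ((w i.succ).1 = (w i.castSucc).1 + 1 ∨ (w i.castSucc).1 = (w i.succ).1 + 1) ∧
      ((w i.succ).2 = (w i.castSucc).2 + 1 ∨ (w i.castSucc).2 = (w i.succ).2 + 1) := by
    simp only [Set.mem_insert_iff, Set.mem_singleton_iff, Prod.mk.injEq]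
    omega
  simp only [IsQPLoop, mem_dyckWalks, step, forall_and, Prod.ext_iff]
  tauto

theorem loopGF_diagonal {R : Type*} [CommRing R] (a b : R) :
    loopGF ({((1 : ℤ), (1 : ℤ)), (1, -1), (-1, 1), (-1, -1)} : Set (ℤ × ℤ)) a b =
      PowerSeries.mk fun n => walkWeight a n 0 * walkWeight b n 0 := by
  unfold loopGF
  congr 1
  funext n
  rw [finsum_subtype_eq_finsum_cond (f := fun w => a ^ hvisits w * b ^ vvisits w)]
  simp only [walkWeight]
  rw [Finset.sum_mul_sum, ← Finset.sum_product', ← finsum_mem_coe_finset]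
  refine finsum_mem_eq_of_bijOn (s := {w | IsQPLoop _ n w})
    (fun w => (fun i => (w i).2, fun i => (w i).1)) ⟨?_, ?_, ?_⟩ fun w _ => rfl
  · intro w hw
    have := (diagonalLoop_iff w).1 hw
    simpa [and_comm] using this
  · intro w _ w' _ h
    simp only [Prod.mk.injEq, funext_iff] at h
    funext i
    exact Prod.ext (h.2 i) (h.1 i)
  · rintro ⟨u, v⟩ h
    simp only [Finset.coe_product, Set.mem_prod, Finset.mem_coe] at h
    exact ⟨fun i => (v i, u i), (diagonalLoop_iff fun i => (v i, u i)).2 ⟨h.2, h.1⟩, rfl⟩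

section DFinite

variable {R : Type*} [CommRing R]

theorem polynomial_smul_eq_mul (p : Polynomial R) (f : R⟦X⟧) : p • f = (p : R⟦X⟧) * f :=
  Algebra.smul_def p f

theorem derivative_polynomial_smul (p : Polynomial R) (f : R⟦X⟧) :
    d⁄dX R (p • f) = Polynomial.derivative p • f + p • d⁄dX R f := by
  simp only [polynomial_smul_eq_mul, Derivation.leibniz, derivative_coe, smul_eq_mul]
  ring

/-- The power series having a multiple by a regular polynomial in `N`. -/
noncomputable def polynomialSaturation (N : Submodule (Polynomial R) R⟦X⟧) :
    Submodule (Polynomial R) R⟦X⟧ :=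
  (Submodule.torsion (Polynomial R) (R⟦X⟧ ⧸ N)).comap N.mkQ

variable [IsDomain R]

theorem mem_polynomialSaturation {N : Submodule (Polynomial R) R⟦X⟧} {f : R⟦X⟧} :
    f ∈ polynomialSaturation N ↔ ∃ p : Polynomial R, p ≠ 0 ∧ p • f ∈ N := by
  simp only [polynomialSaturation, Submodule.mem_comap, Submodule.mem_torsion_iff, Subtype.exists,
    mem_nonZeroDivisors_iff_ne_zero, Submonoid.mk_smul, ← map_smul, exists_prop]
  simp only [Submodule.mkQ_apply, Submodule.Quotient.mk_eq_zero]

theorem mem_polynomialSaturation_of_smul {N : Submodule (Polynomial R) R⟦X⟧} {f : R⟦X⟧}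
    {p : Polynomial R} (hp : p ≠ 0) (h : p • f ∈ polynomialSaturation N) :
    f ∈ polynomialSaturation N := by
  obtain ⟨q, hq, h⟩ := mem_polynomialSaturation.1 h
  exact mem_polynomialSaturation.2 ⟨q * p, mul_ne_zero hq hp, by rwa [mul_smul]⟩

theorem le_polynomialSaturation (N : Submodule (Polynomial R) R⟦X⟧) :
    N ≤ polynomialSaturation N := fun _ h =>
  mem_polynomialSaturation.2 ⟨1, one_ne_zero, by rwa [one_smul]⟩

theorem derivative_mem_polynomialSaturation {s : Set R⟦X⟧}
    (hs : ∀ g ∈ s, d⁄dX R g ∈ polynomialSaturation (Submodule.span (Polynomial R) s))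
    {f : R⟦X⟧} (hf : f ∈ polynomialSaturation (Submodule.span (Polynomial R) s)) :
    d⁄dX R f ∈ polynomialSaturation (Submodule.span (Polynomial R) s) := by
  have hspan : ∀ g ∈ Submodule.span (Polynomial R) s,
      d⁄dX R g ∈ polynomialSaturation (Submodule.span (Polynomial R) s) := by
    intro g hg
    induction hg using Submodule.span_induction with
    | mem g hg => exact hs g hg
    | zero => rw [map_zero]; exact Submodule.zero_mem _
    | add g h _ _ hg hh => rw [map_add]; exact Submodule.add_mem _ hg hh
    | smul p g hg ih =>
      rw [derivative_polynomial_smul]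
      exact Submodule.add_mem _ (Submodule.smul_mem _ _ (le_polynomialSaturation _ hg))
        (Submodule.smul_mem _ _ ih)
  obtain ⟨p, hp, h⟩ := mem_polynomialSaturation.1 hf
  apply mem_polynomialSaturation_of_smul hp
  have := Submodule.sub_mem _ (hspan _ h) (Submodule.smul_mem _ (Polynomial.derivative p) hf)
  rwa [derivative_polynomial_smul, add_sub_cancel_left] at this

/-- A power series is D-finite if it lies, up to a polynomial multiple, in a finitely generated
module of power series which is closed under derivation up to polynomial multiples. -/
theorem isDFinite_of_mem_polynomialSaturation (s : Finset R⟦X⟧)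
    (hs : ∀ g ∈ s, d⁄dX R g ∈
      polynomialSaturation (Submodule.span (Polynomial R) (s : Set R⟦X⟧)))
    {f : R⟦X⟧}
    (hf : f ∈ polynomialSaturation (Submodule.span (Polynomial R) (s : Set R⟦X⟧))) :
    IsDFinite f := by
  have hiter (k : ℕ) : derivativeFun^[k] f ∈
      polynomialSaturation (Submodule.span (Polynomial R) (s : Set R⟦X⟧)) := by
    induction k with
    | zero => exact hf
    | succ k ih =>
      rw [Function.iterate_succ_apply']
      exact derivative_mem_polynomialSaturation hs ih
  choose p hp hmem using fun k => mem_polynomialSaturation.1 (hiter k)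
  let v : Fin (s.card + 1) → Submodule.span (Polynomial R) (s : Set R⟦X⟧) :=
    fun i => ⟨p i • derivativeFun^[(i : ℕ)] f, hmem i⟩
  have hv : ¬ LinearIndependent (Polynomial R) v := by
    intro h
    have h1 := h.cardinal_lift_le_rank
    have h2 := rank_span_finset_le (R := Polynomial R) s
    simp only [Cardinal.mk_fin, Cardinal.lift_natCast] at h1
    have h3 := h1.trans (Cardinal.lift_le.2 h2)
    simp only [Cardinal.lift_natCast, Nat.cast_le] at h3
    omega
  obtain ⟨q, hq, i, hi⟩ := Fintype.not_linearIndependent_iff.1 hv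
  refine ⟨s.card, fun i => q i * p i, ⟨i, mul_ne_zero hi (hp i)⟩, ?_⟩
  have := congrArg Subtype.val hq
  simpa [v, polynomial_smul_eq_mul, mul_assoc] using this

end DFinite

section Recurrences

variable {R : Type*} [CommRing R]

theorem coeff_X_mul_derivative (f : R⟦X⟧) (n : ℕ) :
    coeff n (X * d⁄dX R f) = n * coeff n f := by
  cases n with
  | zero => simp
  | succ n => rw [coeff_succ_X_mul, coeff_derivative]; push_cast; ring

theorem ofNat_eq_C (n : ℕ) [n.AtLeastTwo] : (ofNat(n) : R⟦X⟧) = C (ofNat(n) : R) :=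
  (map_ofNat C n).symm

theorem polynomial_coe_ofNat (n : ℕ) [n.AtLeastTwo] :
    ((ofNat(n) : Polynomial R) : R⟦X⟧) = ofNat(n) :=
  map_ofNat Polynomial.coeToPowerSeries.ringHom n

theorem eq_X_sq_mul {f g : R⟦X⟧} (h0 : coeff 0 f = 0) (h1 : coeff 1 f = 0)
    (h : ∀ n, coeff (n + 2) f = coeff n g) : f = X ^ 2 * g := by
  ext n
  rcases n with _ | _ | n
  · simp [h0]
  · simp [h1, coeff_X_pow_mul']
  · rw [h, ← coeff_X_pow_mul g 2 n]

theorem catalan_sq_differential_equation {c : ℕ → R} (hc0 : c 0 = 1) (hc1 : c 1 = 0)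
    (hc : ∀ n : ℕ, (n + 4) * c (n + 2) = 4 * (n + 1) * c n) {W : R⟦X⟧}
    (hW : W = PowerSeries.mk fun n => c n ^ 2) :
    (X ^ 2 - 16 * X ^ 4) * d⁄dX R (d⁄dX R W) =
      4 - 4 * W - 5 * X * d⁄dX R W + 48 * X ^ 3 * d⁄dX R W + 16 * X ^ 2 * W := by
  have h : X * d⁄dX R (X * d⁄dX R W) + 4 * (X * d⁄dX R W) + 4 * W - 4 =
      X ^ 2 * (16 * (X * d⁄dX R (X * d⁄dX R W) + 2 * (X * d⁄dX R W) + W)) := by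
    simp only [ofNat_eq_C]
    refine eq_X_sq_mul ?_ ?_ fun n => ?_
    · simp only [LinearMap.map_sub, LinearMap.map_add, coeff_C_mul, coeff_X_mul_derivative, hW,
        coeff_mk, coeff_C, hc0]
      simp
    · simp only [LinearMap.map_sub, LinearMap.map_add, coeff_C_mul, coeff_X_mul_derivative, hW,
        coeff_mk, coeff_C, hc1]
      simp
    · simp only [LinearMap.map_sub, LinearMap.map_add, coeff_C_mul, coeff_X_mul_derivative, hW,
        coeff_mk, coeff_C]
      have := hc n
      push_cast
      linear_combination ((n + 4) * c (n + 2) + 4 * (n + 1) * c n) * this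
  simp only [Derivation.leibniz, derivative_X, smul_eq_mul] at h
  linear_combination h

theorem mixed_differential_equation {c x : ℕ → R} {a : R} (hc0 : c 0 = 1)
    (hc1 : c 1 = 0) (hc : ∀ n : ℕ, (n + 4) * c (n + 2) = 4 * (n + 1) * c n) (hx0 : x 0 = 1)
    (hx : ∀ n, (1 - a) * x (n + 2) = a * c n - a ^ 2 * x n)
    {W P : R⟦X⟧} (hW : W = PowerSeries.mk fun n => c n ^ 2)
    (hP : P = PowerSeries.mk fun n => x n * c n) :
    (C (1 - a) * X + 4 * C a ^ 2 * X ^ 3) * d⁄dX R P =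
      2 * C (1 - a) - 2 * C (1 - a) * P - 4 * C a ^ 2 * X ^ 2 * P
        + 4 * C a * X ^ 3 * d⁄dX R W + 4 * C a * X ^ 2 * W := by
  have h : C (1 - a) * (X * d⁄dX R P) + C (2 * (1 - a)) * P - C (2 * (1 - a)) =
      X ^ 2 * (C (4 * a) * (X * d⁄dX R W + W) - C (4 * a ^ 2) * (X * d⁄dX R P + P)) := by
    refine eq_X_sq_mul ?_ ?_ fun n => ?_
    · simp only [LinearMap.map_sub, LinearMap.map_add, coeff_C_mul, coeff_X_mul_derivative, hP,
        coeff_mk, coeff_C, hc0, hx0]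
      simp
    · simp only [LinearMap.map_sub, LinearMap.map_add, coeff_C_mul, coeff_X_mul_derivative, hP,
        coeff_mk, coeff_C, hc1]
      simp
    · simp only [LinearMap.map_sub, LinearMap.map_add, coeff_C_mul, coeff_X_mul_derivative, hW, hP,
        coeff_mk, coeff_C]
      push_cast
      linear_combination (n + 4) * c (n + 2) * hx n + (a * c n - a ^ 2 * x n) * hc n
  simp only [map_mul, map_pow, map_ofNat] at h
  linear_combination h

theorem product_equation {c x y : ℕ → R} {a b : R}
    (hx0 : x 0 = 1) (hx1 : x 1 = 0) (hx : ∀ n, (1 - a) * x (n + 2) = a * c n - a ^ 2 * x n)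
    (hy0 : y 0 = 1) (hy : ∀ n, (1 - b) * y (n + 2) = b * c n - b ^ 2 * y n)
    {W P Q U : R⟦X⟧} (hW : W = PowerSeries.mk fun n => c n ^ 2)
    (hP : P = PowerSeries.mk fun n => x n * c n) (hQ : Q = PowerSeries.mk fun n => y n * c n)
    (hU : U = PowerSeries.mk fun n => x n * y n) :
    (C ((1 - a) * (1 - b)) - C (a ^ 2 * b ^ 2) * X ^ 2) * U =
      C ((1 - a) * (1 - b)) + C (a * b) * X ^ 2 * W - C (a ^ 2 * b) * X ^ 2 * P
        - C (a * b ^ 2) * X ^ 2 * Q := by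
  have h : C ((1 - a) * (1 - b)) * U - C ((1 - a) * (1 - b)) =
      X ^ 2 * (C (a ^ 2 * b ^ 2) * U - C (a ^ 2 * b) * P - C (a * b ^ 2) * Q + C (a * b) * W) := by
    refine eq_X_sq_mul ?_ ?_ fun n => ?_
    · simp only [LinearMap.map_sub, coeff_C_mul, hU, coeff_mk, coeff_C, hx0, hy0]
      simp
    · simp only [LinearMap.map_sub, coeff_C_mul, hU, coeff_mk, coeff_C, hx1]
      simp
    · simp only [LinearMap.map_sub, LinearMap.map_add, coeff_C_mul, hW, hP, hQ, hU, coeff_mk, coeff_C]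
      simp only [Nat.add_eq_zero_iff, OfNat.ofNat_ne_zero, and_false, if_false]
      linear_combination (1 - b) * y (n + 2) * hx n + (a * c n - a ^ 2 * x n) * hy n
  linear_combination h

theorem isDFinite_of_recurrences [IsDomain R] {c x y : ℕ → R} {a b : R}
    (ha : 1 - a ≠ 0) (hb : 1 - b ≠ 0) (hc0 : c 0 = 1) (hc1 : c 1 = 0)
    (hc : ∀ n : ℕ, (n + 4) * c (n + 2) = 4 * (n + 1) * c n)
    (hx0 : x 0 = 1) (hx1 : x 1 = 0) (hx : ∀ n, (1 - a) * x (n + 2) = a * c n - a ^ 2 * x n)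
    (hy0 : y 0 = 1) (hy : ∀ n, (1 - b) * y (n + 2) = b * c n - b ^ 2 * y n) :
    IsDFinite (PowerSeries.mk fun n => x n * y n) := by
  classical
  obtain ⟨W, hW⟩ : ∃ W : R⟦X⟧, W = PowerSeries.mk fun n => c n ^ 2 := ⟨_, rfl⟩
  obtain ⟨P, hP⟩ : ∃ P : R⟦X⟧, P = PowerSeries.mk fun n => x n * c n := ⟨_, rfl⟩
  obtain ⟨Q, hQ⟩ : ∃ Q : R⟦X⟧, Q = PowerSeries.mk fun n => y n * c n := ⟨_, rfl⟩
  obtain ⟨U, hU⟩ : ∃ U : R⟦X⟧, U = PowerSeries.mk fun n => x n * y n := ⟨_, rfl⟩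
  have eW := catalan_sq_differential_equation hc0 hc1 hc hW
  have eP := mixed_differential_equation hc0 hc1 hc hx0 hx hW hP
  have eQ := mixed_differential_equation hc0 hc1 hc hy0 hy hW hQ
  have eU := product_equation hx0 hx1 hx hy0 hy hW hP hQ hU
  rw [← hU]
  let s : Finset R⟦X⟧ := {1, W, d⁄dX R W, P, Q}
  let N := Submodule.span (Polynomial R) (s : Set R⟦X⟧)
  have hN (f : R⟦X⟧) (e p₀ p₁ p₂ p₃ p₄ : Polynomial R) (he : e ≠ 0)
      (h : (e : R⟦X⟧) * f = p₀ + p₁ * W + p₂ * d⁄dX R W + p₃ * P + p₄ * Q) :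
      f ∈ polynomialSaturation N := by
    refine mem_polynomialSaturation.2 ⟨e, he, ?_⟩
    have hs (g : R⟦X⟧) (hg : g ∈ s) (p : Polynomial R) : p • g ∈ N :=
      Submodule.smul_mem _ _ (Submodule.subset_span hg)
    have := add_mem (add_mem (add_mem (add_mem (hs 1 (by simp [s]) p₀) (hs W (by simp [s]) p₁))
      (hs (d⁄dX R W) (by simp [s]) p₂)) (hs P (by simp [s]) p₃)) (hs Q (by simp [s]) p₄)
    simpa only [polynomial_smul_eq_mul, h, mul_one] using this
  have hlead (r : R) (hr : 1 - r ≠ 0) : Polynomial.C (1 - r) * Polynomial.X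
      + 4 * Polynomial.C r ^ 2 * Polynomial.X ^ 3 ≠ 0 := by
    intro h
    apply hr
    have := congrArg (Polynomial.coeff · 1) h
    simpa [mul_assoc, Polynomial.coeff_X_pow_mul', ← map_pow] using this
  refine isDFinite_of_mem_polynomialSaturation s ?_ ?_
  · intro g hg
    simp only [s, Finset.mem_insert, Finset.mem_singleton] at hg
    rcases hg with rfl | rfl | rfl | rfl | rfl
    · simp
    · exact le_polynomialSaturation _ (Submodule.subset_span (by simp [s]))
    · refine hN _ (Polynomial.X ^ 2 - 16 * Polynomial.X ^ 4) 4 (16 * Polynomial.X ^ 2 - 4)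
        (48 * Polynomial.X ^ 3 - 5 * Polynomial.X) 0 0 ?_ ?_
      · intro h
        have := congrArg (Polynomial.coeff · 2) h
        simp [Polynomial.coeff_X_pow] at this
      · push_cast [polynomial_coe_ofNat]
        linear_combination eW
    · refine hN _ _ (2 * Polynomial.C (1 - a)) (4 * Polynomial.C a * Polynomial.X ^ 2)
        (4 * Polynomial.C a * Polynomial.X ^ 3)
        (-2 * Polynomial.C (1 - a) - 4 * Polynomial.C a ^ 2 * Polynomial.X ^ 2) 0 (hlead a ha) ?_
      push_cast [polynomial_coe_ofNat]
      linear_combination eP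
    · refine hN _ _ (2 * Polynomial.C (1 - b)) (4 * Polynomial.C b * Polynomial.X ^ 2)
        (4 * Polynomial.C b * Polynomial.X ^ 3) 0
        (-2 * Polynomial.C (1 - b) - 4 * Polynomial.C b ^ 2 * Polynomial.X ^ 2) (hlead b hb) ?_
      push_cast [polynomial_coe_ofNat]
      linear_combination eQ
  · refine hN _ (Polynomial.C ((1 - a) * (1 - b)) - Polynomial.C (a ^ 2 * b ^ 2) * Polynomial.X ^ 2)
      (Polynomial.C ((1 - a) * (1 - b))) (Polynomial.C (a * b) * Polynomial.X ^ 2) 0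
      (-Polynomial.C (a ^ 2 * b) * Polynomial.X ^ 2)
      (-Polynomial.C (a * b ^ 2) * Polynomial.X ^ 2) ?_ ?_
    · intro h
      have := congrArg (Polynomial.coeff · 0) h
      simp [ha, hb] at this
    · push_cast
      linear_combination eU

end Recurrences

/-- Model 2 (the diagonal walk): `G(t;a,b)` is D-finite. -/
theorem model2_Gab_dfinite :
    IsDFinite (loopGF ({((1:ℤ), (1:ℤ)), (1, -1), (-1, 1), (-1, -1)} : Set (ℤ × ℤ))
      (MvPolynomial.X (0 : Fin 2) : MvPolynomial (Fin 2) ℚ) (MvPolynomial.X (1 : Fin 2))) := by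
  rw [loopGF_diagonal]
  have hX (i : Fin 2) : (1 - MvPolynomial.X i : MvPolynomial (Fin 2) ℚ) ≠ 0 := by
    intro h
    have := congrArg MvPolynomial.constantCoeff h
    simp at this
  exact isDFinite_of_recurrences (c := fun n => walkWeight 1 n 0) (hX 0) (hX 1)
    (walkWeight_zero_zero _) (walkWeight_one_zero _) catalan_recurrence
    (walkWeight_zero_zero _) (walkWeight_one_zero _) (walkWeight_recurrence _)
    (walkWeight_zero_zero _) (walkWeight_recurrence _)
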